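/- For a permutation π of F_{2^k}, arbitrary g : F_{2^k} → F_{2^k}, arbitrary h : F_{2^k} → F_2^{m-k}, and G(x,y) = (x^{2^i}π(y) + g(y), h(y)), the differential counting function satisfies: δ_G((u,0),(a,b)) = 2^k if b = 0 (and u ≠ 0), δ_G((u,0),(a,b)) = 0 if b ≠ 0, and δ_G((u,v),(a,b)) = δ_h(v,b) whenever v ≠ 0. In particular G is differentially 2^k-uniform. -/

import Mathlib

/-- Over a finite field of characteristic two, a nonconstant affine function of `x ^ 2 ^ i`
takes every value exactly once. -/
theorem existsUnique_pow_two_pow_mul_add {F : Type*} [Field F] [Finite F] [CharP F 2] (i : ℕ)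
    {c : F} (hc : c ≠ 0) (d a : F) : ∃! x : F, x ^ 2 ^ i * c + d = a := by
  have hinj : Function.Injective (fun x : F => x ^ 2 ^ i) := fun x y hxy =>
    iterateFrobenius_inj F 2 i (by simpa [iterateFrobenius_def] using hxy)
  obtain ⟨x, hx⟩ := (Finite.injective_iff_surjective.mp hinj) ((a - d) / c)
  refine ⟨x, ?_, fun y hy => hinj ?_⟩
  · simp only at hx ⊢
    rw [hx, div_mul_cancel₀ _ hc, sub_add_cancel]
  · simp only at hx hy ⊢
    rw [hx, eq_div_iff hc, ← hy, add_sub_cancel_right]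

/-- A set of pairs whose second components determine the first, and range over `s`, has the
cardinality of `s`. -/
theorem natCard_eq_of_existsUnique_fst {A B : Type*} {P : A → B → Prop} {s : Set B}
    (hP : ∀ y ∈ s, ∃! x, P x y) :
    Nat.card {p : A × B | P p.1 p.2 ∧ p.2 ∈ s} = Nat.card s := by
  refine Nat.card_congr (Equiv.ofBijective (fun p => ⟨p.1.2, p.2.2⟩) ⟨?_, ?_⟩)
  · rintro ⟨⟨x, y⟩, hp, hy⟩ ⟨⟨x', y'⟩, hp', hy'⟩ heq
    obtain rfl : y = y' := congrArg Subtype.val heq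
    obtain rfl : x = x' := (hP y hy).unique hp hp'
    rfl
  · rintro ⟨y, hy⟩
    obtain ⟨x, hx, -⟩ := hP y hy
    exact ⟨⟨(x, y), hx, hy⟩, rfl⟩


open Finset

variable {K : Type*} [Field K] [Fintype K] [Algebra (ZMod 2) K]

/-- The differential counting function of a vectorial function `F`. -/
noncomputable def delta {A B : Type*} [Add A] [Add B] (F : A → B) (a : A) (b : B) : ℕ :=
  Nat.card {x : A | F (x + a) + F x = b}

theorem stmt8 (k m i : ℕ) (hk : 0 < k) (hm : k ≤ m) (hi : i < k)
    (hcard : Fintype.card K = 2 ^ k)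
    (π : K → K) (hπ : Function.Bijective π)
    (g : K → K) (h : K → Fin (m - k) → ZMod 2)
    (G : K × K → K × (Fin (m - k) → ZMod 2))
    (hG : ∀ p : K × K, G p = (p.1 ^ (2 ^ i) * π p.2 + g p.2, h p.2)) :
    (∀ (u : K) (a : K), u ≠ 0 → delta G (u, 0) (a, 0) = 2 ^ k) ∧
    (∀ (u : K) (a : K) (b : Fin (m - k) → ZMod 2), u ≠ 0 → b ≠ 0 →
      delta G (u, 0) (a, b) = 0) ∧
    (∀ (u v : K) (a : K) (b : Fin (m - k) → ZMod 2), v ≠ 0 →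
      delta G (u, v) (a, b) = delta h v b) ∧
    (∀ (u v : K) (a : K) (b : Fin (m - k) → ZMod 2), (u, v) ≠ 0 →
      delta G (u, v) (a, b) ≤ 2 ^ k) := by
  have hchar : CharP K 2 := charP_of_injective_algebraMap (algebraMap (ZMod 2) K).injective 2
  have hadd (x y : K) : (x + y) ^ 2 ^ i = x ^ 2 ^ i + y ^ 2 ^ i := add_pow_char_pow x y 2 i
  have hself (b : Fin (m - k) → ZMod 2) : b + b = 0 := funext fun j => CharTwo.add_self_eq_zero _
  have hzero : ∀ u a : K, u ≠ 0 → delta G (u, 0) (a, 0) = 2 ^ k := by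
    intro u a hu
    have huq : u ^ 2 ^ i ≠ 0 := pow_ne_zero _ hu
    obtain ⟨y, hy⟩ := hπ.2 (a / u ^ 2 ^ i)
    rw [delta, ← hcard, ← Nat.card_eq_fintype_card]
    have hset : {p : K × K | G (p + (u, 0)) + G p = (a, 0)} = Set.range fun x : K => (x, y) := by
      ext ⟨x, z⟩
      have hsum : (x ^ 2 ^ i + u ^ 2 ^ i) * π z + g z + (x ^ 2 ^ i * π z + g z)
          = π z * u ^ 2 ^ i := by
        linear_combination (x ^ 2 ^ i * π z + g z) * (CharTwo.two_eq_zero : (2 : K) = 0)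
      simp only [Set.mem_ofPred_eq, hG, Prod.mk_add_mk, add_zero, hadd, hself, hsum,
        Prod.mk.injEq, and_true, Set.mem_range, exists_eq_left]
      rw [← eq_div_iff huq, ← hy, hπ.1.eq_iff, eq_comm]
    rw [hset]
    exact Nat.card_range_of_injective fun x x' hx => congrArg Prod.fst hx
  have hne_zero : ∀ (u a : K) (b : Fin (m - k) → ZMod 2), u ≠ 0 → b ≠ 0 →
      delta G (u, 0) (a, b) = 0 := by
    intro u a b _ hb
    have hset : {p : K × K | G (p + (u, 0)) + G p = (a, b)} = ∅ := by
      ext ⟨x, z⟩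
      simp [hG, hself, hb.symm]
    rw [delta, hset]
    simp
  have hsnd : ∀ (u v a : K) (b : Fin (m - k) → ZMod 2), v ≠ 0 →
      delta G (u, v) (a, b) = delta h v b := by
    intro u v a b hv
    rw [delta, delta, ← natCard_eq_of_existsUnique_fst (s := {y | h (y + v) + h y = b})
      (P := fun x y => x ^ 2 ^ i * (π (y + v) + π y)
        + (u ^ 2 ^ i * π (y + v) + g (y + v) + g y) = a)]
    · refine congrArg (fun S : Set (K × K) => Nat.card S) (Set.ext fun p => ?_)
      simp only [hG, Prod.fst_add, Prod.snd_add, hadd, Prod.mk_add_mk, Prod.mk.injEq,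
        Set.mem_ofPred_eq]
      refine and_congr_left' (Eq.congr_left ?_)
      ring
    · intro y _
      refine existsUnique_pow_two_pow_mul_add i (fun hc => hv ?_) _ a
      simpa using hπ.1 (CharTwo.add_eq_zero.mp hc)
  refine ⟨hzero, hne_zero, hsnd, fun u v a b huv => ?_⟩
  by_cases hv : v = 0
  · subst hv
    have hu : u ≠ 0 := fun hu => huv (by simp [hu])
    by_cases hb : b = 0
    · exact hb ▸ (hzero u a hu).le
    · simp [hne_zero u a b hu hb]
  · rw [hsnd u v a b hv, delta, ← hcard, ← Nat.card_eq_fintype_card]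
    exact Nat.card_le_card_of_injective _ Subtype.val_injective
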